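/- arXiv:1810.02227 — 2 statements merged into one kernel-verified Lean document; each statement's English description precedes it below -/
import Mathlib

section
/- Let b_0, …, b_6 be any valid 6-round trajectory of activity patterns whose initial pattern b_0 is not identically false, and let S be a natural number with S ≥ 5 · (total active-function count of the trajectory). Then S ≥ 30, and consequently ((1/2 : ℝ))^(6·S) ≤ (1/2)^180 and ((1/2 : ℝ))^(3·S) ≤ (1/2)^90. -/
/-- The block shuffle of the 16-branch generalized Feistel network (Randen):
position `k` receives the branch previously at position `shuffle k`. -/
def shuffle : Fin 16 → Fin 16 :=
  ![7, 2, 13, 4, 11, 8, 3, 6, 15, 0, 9, 10, 1, 14, 5, 12]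

/-- An activity pattern: `b k = true` means branch `k` carries a nonzero difference. -/
abbrev Pattern := Fin 16 → Bool

/-- The even branch `b (2 i)` feeding round function `i`. -/
def evenBr (b : Pattern) (i : Fin 8) : Bool := b ⟨2 * i.val, by have := i.isLt; omega⟩

/-- The odd branch `b (2 i + 1)` receiving the output of round function `i`. -/
def oddBr (b : Pattern) (i : Fin 8) : Bool := b ⟨2 * i.val + 1, by have := i.isLt; omega⟩

/-- The intermediate pattern `c` with `c (2 i) = b (2 i)` and `c (2 i + 1) = t i`. -/
def combine (b : Pattern) (t : Fin 8 → Bool) : Pattern := fun k =>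
  if k.val % 2 = 0 then b k else t ⟨k.val / 2, by have := k.isLt; omega⟩

/-- One round of truncated-differential propagation: `b` transforms into `b'` iff
there is `t : Fin 8 → Bool` with `t i = false` whenever both inputs of round
function `i` are inactive, `t i = true` whenever exactly one input is active
(`t i` is unconstrained if both inputs are active, since differences may cancel),
and `b' k = c (shuffle k)` where `c (2 i) = b (2 i)`, `c (2 i + 1) = t i`. -/
def Step (b b' : Pattern) : Prop :=
  ∃ t : Fin 8 → Bool,
    (∀ i : Fin 8,
      ((evenBr b i = false ∧ oddBr b i = false) → t i = false) ∧
      (xor (evenBr b i) (oddBr b i) = true → t i = true)) ∧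
    (∀ k : Fin 16, b' k = combine b t (shuffle k))

/-- Number of active functions of a pattern: the number of `i : Fin 8` with
`b (2 i) = true`. -/
def activeFuncs (b : Pattern) : ℕ :=
  (Finset.univ.filter fun i : Fin 8 => evenBr b i = true).card

/-- A valid `r`-round trajectory: each `b (j + 1)` arises from `b j` by one round. -/
def ValidTraj (r : ℕ) (b : ℕ → Pattern) : Prop :=
  ∀ j < r, Step (b j) (b (j + 1))

/-- Total active-function count of an `r`-round trajectory. -/
def totalActive (r : ℕ) (b : ℕ → Pattern) : ℕ :=
  ∑ j ∈ Finset.range r, activeFuncs (b j)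

/-- Three consecutive sets of active functions are balanced with respect to the wirings `q`, `r` if,
at every function `i`, the branches `q i ∈ A`, `i ∈ B`, `r i ∈ C` are not active one at a time. -/
def RoundBalanced (q r : Equiv.Perm (Fin 8)) (A B C : Finset (Fin 8)) : Prop :=
  ∀ i, (q i ∈ A → i ∈ B ∨ r i ∈ C) ∧ (i ∈ B → q i ∈ A ∨ r i ∈ C) ∧ (r i ∈ C → q i ∈ A ∨ i ∈ B)

/-- The functions forced to be active after `A` and `B`. -/
def forced (q r : Equiv.Perm (Fin 8)) (A B : Finset (Fin 8)) : Finset (Fin 8) :=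
  Finset.univ.filter fun k => ¬ (r.symm k ∈ B ↔ q (r.symm k) ∈ A)

/-- No function receives two active inputs from `A` and `B`. -/
def NoCollision (q : Equiv.Perm (Fin 8)) (A B : Finset (Fin 8)) : Prop :=
  ∀ i ∈ B, q i ∉ A

instance (q : Equiv.Perm (Fin 8)) (A B : Finset (Fin 8)) : Decidable (NoCollision q A B) :=
  inferInstanceAs (Decidable (∀ i ∈ B, q i ∉ A))

/-- From `A`, `B` the next two rounds are collision-free, and the next three rounds have
at least four active functions. -/
def Spreads (q r : Equiv.Perm (Fin 8)) (A B : Finset (Fin 8)) : Prop :=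
  NoCollision q A B ∧ NoCollision q B (forced q r A B) ∧
    4 ≤ (forced q r A B).card + (forced q r B (forced q r A B)).card +
      (forced q r (forced q r A B) (forced q r B (forced q r A B))).card

instance (q r : Equiv.Perm (Fin 8)) (A B : Finset (Fin 8)) : Decidable (Spreads q r A B) :=
  inferInstanceAs (Decidable (_ ∧ _ ∧ _))

/-- Every end of a three-round window with exactly two active functions spreads. -/
def Expanding (q r : Equiv.Perm (Fin 8)) : Prop :=
  ∀ i, Spreads q r {i} ∅ ∧ Spreads q r ∅ {r i} ∧ Spreads q r {i} {r i}

instance (q r : Equiv.Perm (Fin 8)) : Decidable (Expanding q r) :=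
  inferInstanceAs (Decidable (∀ _, _))

section RoundBalanced

variable {q r : Equiv.Perm (Fin 8)} {A B C D E F : Finset (Fin 8)}

theorem RoundBalanced.symm (h : RoundBalanced q r A B C) : RoundBalanced r q C B A := fun i => by
  have := h i
  tauto

theorem RoundBalanced.forced_subset (h : RoundBalanced q r A B C) : forced q r A B ⊆ C := by
  intro k hk
  have hi := h (r.symm k)
  simp only [forced, Finset.mem_filter, Finset.mem_univ, true_and] at hk
  rw [Equiv.apply_symm_apply] at hi
  tauto

theorem RoundBalanced.eq_forced (h : RoundBalanced q r A B C) (hAB : NoCollision q A B) :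
    C = forced q r A B := by
  refine (Finset.Subset.antisymm h.forced_subset fun k hk => ?_).symm
  have hi := h (r.symm k)
  have hn := hAB (r.symm k)
  simp only [forced, Finset.mem_filter, Finset.mem_univ, true_and]
  rw [Equiv.apply_symm_apply] at hi
  tauto

theorem RoundBalanced.eq_empty (h : RoundBalanced q r A ∅ ∅) : A = ∅ := by
  refine Finset.eq_empty_of_forall_notMem fun k hk => ?_
  have hi := (h (q.symm k)).1
  simp [hk] at hi

theorem RoundBalanced.exists_two_active (h : RoundBalanced q r A B C)
    (hne : ¬ (A = ∅ ∧ B = ∅ ∧ C = ∅)) :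
    ∃ i, (q i ∈ A ∧ i ∈ B) ∨ (q i ∈ A ∧ r i ∈ C) ∨ (i ∈ B ∧ r i ∈ C) := by
  by_contra! hno
  refine hne ⟨?_, ?_, ?_⟩ <;> refine Finset.eq_empty_of_forall_notMem fun k hk => ?_
  · have hi := h (q.symm k)
    have hn := hno (q.symm k)
    rw [Equiv.apply_symm_apply] at hi hn
    tauto
  · have hi := h k
    have hn := hno k
    tauto
  · have hi := h (r.symm k)
    have hn := hno (r.symm k)
    rw [Equiv.apply_symm_apply] at hi hn
    tauto

theorem RoundBalanced.two_le_card (h : RoundBalanced q r A B C)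
    (hne : ¬ (A = ∅ ∧ B = ∅ ∧ C = ∅)) :
    2 ≤ A.card + B.card + C.card := by
  obtain ⟨i, ⟨h₁, h₂⟩ | ⟨h₁, h₂⟩ | ⟨h₁, h₂⟩⟩ := h.exists_two_active hne <;>
  · have := Finset.card_pos.2 ⟨_, h₁⟩
    have := Finset.card_pos.2 ⟨_, h₂⟩
    omega

theorem Spreads.four_le_card (hs : Spreads q r B C) (h₁ : RoundBalanced q r B C D)
    (h₂ : RoundBalanced q r C D E) (h₃ : RoundBalanced q r D E F) :
    4 ≤ D.card + E.card + F.card := by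
  obtain ⟨n₁, n₂, hcard⟩ := hs
  obtain rfl := h₁.eq_forced n₁
  obtain rfl := h₂.eq_forced n₂
  exact hcard.trans (Nat.add_le_add_left (Finset.card_le_card h₃.forced_subset) _)

theorem eq_singleton_of_mem_of_card_le_one {α : Type*} {s : Finset α} {a : α} (ha : a ∈ s)
    (hs : s.card ≤ 1) : s = {a} :=
  Finset.eq_singleton_iff_unique_mem.2 ⟨ha, fun _ hx => Finset.card_le_one.1 hs _ hx _ ha⟩

theorem RoundBalanced.spreads (h : RoundBalanced q r A B C) (hexp : Expanding q r)
    (hne : ¬ (A = ∅ ∧ B = ∅ ∧ C = ∅)) (hcard : A.card + B.card + C.card ≤ 2) :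
    Spreads q r B C := by
  obtain ⟨i, ⟨h₁, h₂⟩ | ⟨h₁, h₂⟩ | ⟨h₁, h₂⟩⟩ := h.exists_two_active hne <;>
    have p₁ := Finset.card_pos.2 ⟨_, h₁⟩ <;>
    have p₂ := Finset.card_pos.2 ⟨_, h₂⟩
  · rw [eq_singleton_of_mem_of_card_le_one h₂ (by omega),
      Finset.card_eq_zero.1 (show C.card = 0 by omega)]
    exact (hexp i).1
  · rw [eq_singleton_of_mem_of_card_le_one h₂ (by omega),
      Finset.card_eq_zero.1 (show B.card = 0 by omega)]
    exact (hexp i).2.1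
  · rw [eq_singleton_of_mem_of_card_le_one h₁ (by omega),
      eq_singleton_of_mem_of_card_le_one h₂ (by omega)]
    exact (hexp i).2.2

/-- Of the two halves of a six-round trajectory with at most five active functions, one has at most
two; it then spreads into the other half, forwards or backwards. -/
theorem six_le_card_of_balanced (hqr : Expanding q r) (hrq : Expanding r q)
    (h₀ : RoundBalanced q r A B C) (h₁ : RoundBalanced q r B C D) (h₂ : RoundBalanced q r C D E)
    (h₃ : RoundBalanced q r D E F) (hne : ¬ (A = ∅ ∧ B = ∅)) :
    6 ≤ (A.card + B.card + C.card) + (D.card + E.card + F.card) := by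
  have hABC : ¬ (A = ∅ ∧ B = ∅ ∧ C = ∅) := fun h => hne ⟨h.1, h.2.1⟩
  have hFED : ¬ (F = ∅ ∧ E = ∅ ∧ D = ∅) := by
    rintro ⟨rfl, rfl, rfl⟩
    obtain rfl := h₂.eq_empty
    obtain rfl := h₁.eq_empty
    exact hne ⟨h₀.eq_empty, rfl⟩
  have hlow := h₀.two_le_card hABC
  have hhigh := h₃.symm.two_le_card hFED
  by_cases hle : A.card + B.card + C.card ≤ 2
  · have := (h₀.spreads hqr hABC hle).four_le_card h₁ h₂ h₃
    omega
  · by_cases hle' : F.card + E.card + D.card ≤ 2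
    · have := (h₃.symm.spreads hrq hFED hle').four_le_card h₂.symm h₁.symm h₀.symm
      omega
    · omega

end RoundBalanced

/-- The odd input of function `i` is the even branch of function `oddSource i` one round earlier. -/
def oddSource : Equiv.Perm (Fin 8) where
  toFun := ![1, 2, 4, 3, 0, 5, 7, 6]
  invFun := ![4, 0, 1, 3, 2, 5, 7, 6]
  left_inv := by decide
  right_inv := by decide

/-- The output of function `i` becomes the even branch of function `outTarget i`. -/
def outTarget : Equiv.Perm (Fin 8) where
  toFun := ![6, 3, 7, 0, 5, 2, 1, 4]
  invFun := ![3, 6, 5, 1, 7, 4, 0, 2]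
  left_inv := by decide
  right_inv := by decide

theorem expanding_oddSource_outTarget : Expanding oddSource outTarget := by
  decide +kernel

theorem expanding_outTarget_oddSource : Expanding outTarget oddSource := by
  decide +kernel

/-- The set of active functions of a pattern. -/
def activeSet (b : Pattern) : Finset (Fin 8) :=
  Finset.univ.filter fun i => evenBr b i = true

theorem mem_activeSet {b : Pattern} {i : Fin 8} : i ∈ activeSet b ↔ evenBr b i = true := by
  simp [activeSet]

theorem Step.oddBr_eq {b b' : Pattern} (h : Step b b') (i : Fin 8) :
    oddBr b' i = evenBr b (oddSource i) := by
  obtain ⟨t, -, hb'⟩ := h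
  rw [oddBr, hb']
  fin_cases i <;> rfl

theorem Step.evenBr_outTarget {b b' : Pattern} (h : Step b b') (i : Fin 8) :
    (evenBr b i = false ∧ oddBr b i = false → evenBr b' (outTarget i) = false) ∧
      (xor (evenBr b i) (oddBr b i) = true → evenBr b' (outTarget i) = true) := by
  obtain ⟨t, ht, hb'⟩ := h
  have hout : evenBr b' (outTarget i) = t i := by
    rw [evenBr, hb']
    fin_cases i <;> rfl
  rw [hout]
  exact ht i

theorem Step.balanced {b b' b'' : Pattern} (h : Step b b') (h' : Step b' b'') :
    RoundBalanced oddSource outTarget (activeSet b) (activeSet b') (activeSet b'') := fun i => by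
  have hi := h'.evenBr_outTarget i
  rw [h.oddBr_eq i] at hi
  simp only [mem_activeSet]
  revert hi
  generalize evenBr b (oddSource i) = x
  generalize evenBr b' i = y
  generalize evenBr b'' (outTarget i) = z
  revert x y z
  decide

theorem Step.activeSet_ne_empty {b b' : Pattern} (h : Step b b') (hnz : ∃ k, b k = true) :
    ¬ (activeSet b = ∅ ∧ activeSet b' = ∅) := by
  rintro ⟨hb, hb'⟩
  have heven : ∀ i, evenBr b i = false := fun i => by
    have : i ∉ activeSet b := by simp [hb]
    simpa [mem_activeSet] using this
  have hodd : ∀ i, oddBr b i = false := fun i => by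
    have hi := (h.evenBr_outTarget i).2
    have : outTarget i ∉ activeSet b' := by simp [hb']
    rw [mem_activeSet] at this
    simpa [heven i] using mt hi this
  obtain ⟨k, hk⟩ := hnz
  have : b k = false := by
    rcases Nat.even_or_odd' k.val with ⟨m, hm | hm⟩
    · exact (congrArg b (Fin.ext hm)).trans (heven ⟨m, by omega⟩)
    · exact (congrArg b (Fin.ext hm)).trans (hodd ⟨m, by omega⟩)
  simp [this] at hk

theorem six_le_totalActive {b : ℕ → Pattern} (hvalid : ValidTraj 6 b) (hnz : ∃ k, b 0 k = true) :
    6 ≤ totalActive 6 b := by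
  have hbal : ∀ j, j + 1 < 6 → RoundBalanced oddSource outTarget (activeSet (b j))
      (activeSet (b (j + 1))) (activeSet (b (j + 2))) := fun j hj =>
    (hvalid j (by omega)).balanced (hvalid (j + 1) hj)
  have := six_le_card_of_balanced expanding_oddSource_outTarget expanding_outTarget_oddSource
    (hbal 0 (by omega)) (hbal 1 (by omega)) (hbal 2 (by omega)) (hbal 3 (by omega))
    ((hvalid 0 (by omega)).activeSet_ne_empty hnz)
  have hcard : ∀ j, activeFuncs (b j) = (activeSet (b j)).card := fun _ => rfl
  simp only [totalActive, Finset.sum_range_succ, Finset.sum_range_zero, hcard]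
  simp only [Nat.reduceAdd] at this
  omega

theorem six_rounds_sbox_bounds
    (b : ℕ → Pattern) (hvalid : ValidTraj 6 b) (hnz : ∃ k, b 0 k = true)
    (S : ℕ) (hS : 5 * totalActive 6 b ≤ S) :
    30 ≤ S ∧ ((1 / 2 : ℝ)) ^ (6 * S) ≤ (1 / 2 : ℝ) ^ (180 : ℕ) ∧
      ((1 / 2 : ℝ)) ^ (3 * S) ≤ (1 / 2 : ℝ) ^ (90 : ℕ) := by
  have hS30 : 30 ≤ S := by
    have := six_le_totalActive hvalid hnz
    omega
  exact ⟨hS30, pow_le_pow_of_le_one (by norm_num) (by norm_num) (by omega),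
    pow_le_pow_of_le_one (by norm_num) (by norm_num) (by omega)⟩
end

section
/- Every valid 18-round trajectory of activity patterns whose initial pattern is not identically false has total active-function count at least 39. -/
/-- The set of those `n < 2 ^ (k + 1 + j)` whose bit `k` is set, encoded as a natural number. -/
def bitMask (k : ℕ) : ℕ → ℕ
  | 0 => ((1 <<< 2 ^ k) - 1) <<< 2 ^ k
  | j + 1 => bitMask k j ||| bitMask k j <<< 2 ^ (k + 1 + j)

/-- A set of pairs (pattern code `n < 2 ^ 16`, cost `c`) is encoded as the natural number with bits
`n + 2 ^ 16 * c`. Such a set is pushed through the round function with input bit `x` and target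
bit `y`, all costs being below `2 ^ 6`. -/
def pairStep (S x y : ℕ) : ℕ :=
  let A := S &&& bitMask x (21 - x)
  let B := A &&& bitMask y (21 - y)
  (S ^^^ A) ||| (B ||| B >>> 2 ^ y ||| (A ^^^ B) <<< 2 ^ y) <<< 2 ^ 16

/-- The push of `S` through the first `i` round functions of a round, branch `k` being stored in
bit `p k` of the pattern code. -/
def pairSteps (p : Fin 16 → Fin 16) (S : ℕ) : ℕ → ℕ
  | 0 => S
  | i + 1 => pairStep (pairSteps p S i) (p (Fin.ofNat 16 (2 * i))) (p (Fin.ofNat 16 (2 * i + 1)))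

/-- The bits in which the branches are stored after `r` rounds: the shuffle relabels branches
instead of moving bits. -/
def layout : ℕ → Fin 16 → Fin 16
  | 0 => id
  | r + 1 => layout r ∘ shuffle

/-- The pairs of a pattern and a cost at most `38` reachable from nonzero patterns in `r` rounds. -/
def reachable : ℕ → ℕ
  | 0 => (1 <<< 2 ^ 16) - 2
  | r + 1 => pairSteps (layout r) (reachable r) 8 &&& ((1 <<< (2 ^ 16 * 39)) - 1)

theorem reachable_eighteen : reachable 18 = 0 := by
  decide +kernel

theorem testBit_bitMask (k j n : ℕ) :
    (bitMask k j).testBit n = (decide (n < 2 ^ (k + 1 + j)) && n.testBit k) := by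
  induction j generalizing n with
  | zero =>
    have hk : 2 ^ (k + 1) = 2 ^ k + 2 ^ k := by ring
    simp only [bitMask, Nat.one_shiftLeft, Nat.testBit_shiftLeft, Nat.testBit_two_pow_sub_one,
      Nat.add_zero, hk]
    by_cases h₁ : n < 2 ^ k
    · simp [Nat.testBit_lt_two_pow h₁, h₁]
    · obtain ⟨m, rfl⟩ := Nat.exists_eq_add_of_le (not_lt.mp h₁)
      by_cases h₂ : m < 2 ^ k
      · simp [Nat.testBit_two_pow_add_eq, Nat.testBit_lt_two_pow h₂, h₂]
      · simp [h₂]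
  | succ j ih =>
    have hk : 2 ^ (k + 1 + (j + 1)) = 2 ^ (k + 1 + j) + 2 ^ (k + 1 + j) := by ring
    simp only [bitMask, Nat.testBit_or, Nat.testBit_shiftLeft, ih, hk]
    by_cases h₁ : n < 2 ^ (k + 1 + j)
    · simp [h₁, Nat.lt_add_right _ h₁]
    · obtain ⟨m, rfl⟩ := Nat.exists_eq_add_of_le (not_lt.mp h₁)
      simp [Nat.testBit_two_pow_add_gt (show k < k + 1 + j by omega)]

/-- The code of the pattern `b`, branch `k` being stored in bit `p k`. -/
def code (p : Fin 16 → Fin 16) (b : Pattern) : ℕ :=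
  ∑ k, (b k).toNat * 2 ^ (p k : ℕ)

theorem code_update (p : Fin 16 → Fin 16) (b : Pattern) (v : Fin 16) (t : Bool) :
    code p (Function.update b v t) + (b v).toNat * 2 ^ (p v : ℕ) =
      code p b + t.toNat * 2 ^ (p v : ℕ) := by
  unfold code
  rw [← Finset.add_sum_erase _ _ (Finset.mem_univ v),
    ← Finset.add_sum_erase (a := v) _ (fun k => (b k).toNat * 2 ^ (p k : ℕ)) (Finset.mem_univ v),
    Finset.sum_congr rfl fun k hk => by
      rw [Function.update_of_ne (Finset.ne_of_mem_erase hk)]]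
  simp only [Function.update_self]
  ring

theorem ofBits_eq_sum {n : ℕ} (f : Fin n → Bool) :
    Nat.ofBits f = ∑ k, (f k).toNat * 2 ^ (k : ℕ) := by
  induction n with
  | zero => simp
  | succ n ih =>
    simp only [Nat.ofBits_succ, ih, Fin.sum_univ_succ, Finset.mul_sum, Function.comp_apply,
      Fin.val_succ, Fin.val_zero, pow_succ, pow_zero, mul_one]
    rw [add_comm]
    congr 1
    exact Finset.sum_congr rfl fun _ _ => by ring

theorem code_eq_ofBits (p : Equiv.Perm (Fin 16)) (b : Pattern) :
    code p b = Nat.ofBits (b ∘ p.symm) := by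
  rw [ofBits_eq_sum, ← Equiv.sum_comp p]
  simp [code]

theorem exists_perm_coe_eq {p : Fin 16 → Fin 16} (hp : p.Injective) :
    ∃ e : Equiv.Perm (Fin 16), ⇑e = p :=
  ⟨Equiv.ofBijective p (Finite.injective_iff_bijective.mp hp), rfl⟩

theorem code_lt {p : Fin 16 → Fin 16} (hp : p.Injective) (b : Pattern) : code p b < 2 ^ 16 := by
  obtain ⟨e, rfl⟩ := exists_perm_coe_eq hp
  exact code_eq_ofBits e b ▸ Nat.ofBits_lt_two_pow _

theorem testBit_code {p : Fin 16 → Fin 16} (hp : p.Injective) (b : Pattern) (k : Fin 16) (c : ℕ) :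
    (code p b + 2 ^ 16 * c).testBit (p k) = b k := by
  rw [add_comm, Nat.testBit_two_pow_mul_add _ (code_lt hp b), if_pos (p k).isLt]
  obtain ⟨e, rfl⟩ := exists_perm_coe_eq hp
  rw [code_eq_ofBits, Nat.testBit_ofBits_lt _ _ (e k).isLt, Fin.eta, Function.comp_apply,
    Equiv.symm_apply_apply]

theorem testBit_pairStep {p : Fin 16 → Fin 16} (hp : p.Injective) {S c : ℕ} (hc : c < 2 ^ 6)
    {b : Pattern} (hS : S.testBit (code p b + 2 ^ 16 * c) = true) {u v : Fin 16} {t : Bool}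
    (h₀ : b u = false → t = b v) (h₁ : b u = true → b v = false → t = true) :
    (pairStep S (p u) (p v)).testBit
      (code p (Function.update b v t) + 2 ^ 16 * (c + (b u).toNat)) = true := by
  have hlt : code p b + 2 ^ 16 * c < 2 ^ 22 := by
    have := code_lt hp b
    omega
  have mask (k : Fin 16) :
      (bitMask (p k) (21 - p k)).testBit (code p b + 2 ^ 16 * c) = b k := by
    rw [testBit_bitMask, testBit_code hp, show (p k : ℕ) + 1 + (21 - p k) = 22 by omega,
      decide_eq_true hlt, Bool.true_and]
  have hup := code_update p b v t
  set n := code p b + 2 ^ 16 * c with hn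
  simp only [pairStep, Nat.testBit_or, Nat.testBit_xor, Nat.testBit_and, Nat.testBit_shiftLeft,
    Nat.testBit_shiftRight, Bool.or_eq_true]
  cases hu : b u
  · left
    obtain rfl := h₀ hu
    have : code p (Function.update b v (b v)) + 2 ^ 16 * (c + false.toNat) = n := by simp [hn]
    rw [this, hS, mask, hu]
    rfl
  · right
    have hm : code p (Function.update b v t) + 2 ^ 16 * (c + true.toNat) - 2 ^ 16 =
        code p (Function.update b v t) + 2 ^ 16 * c := by simp; omega
    have hge : 2 ^ 16 ≤ code p (Function.update b v t) + 2 ^ 16 * (c + true.toNat) := by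
      simp; omega
    rw [hm, decide_eq_true hge, Bool.true_and]
    generalize code p (Function.update b v t) = d at hup ⊢
    cases hv : b v
    · obtain rfl := h₁ hu hv
      have : d + 2 ^ 16 * c - 2 ^ (p v : ℕ) = n := by simp [hv] at hup; omega
      have hle : 2 ^ (p v : ℕ) ≤ d + 2 ^ 16 * c := by simp [hv] at hup; omega
      simp [-Nat.reducePow, this, hS, mask, hu, hv, hle]
    · cases t
      · have : 2 ^ (p v : ℕ) + (d + 2 ^ 16 * c) = n := by simp [hv] at hup; omega
        simp [-Nat.reducePow, this, hS, mask, hu, hv]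
      · have : d + 2 ^ 16 * c = n := by simp [hv] at hup; omega
        simp [-Nat.reducePow, this, hS, mask, hu, hv]

/-- The pattern `b` after the first `i` round functions of a round have acted with outputs `t`. -/
def partialCombine (b : Pattern) (t : Fin 8 → Bool) : ℕ → Pattern
  | 0 => b
  | i + 1 => Function.update (partialCombine b t i) (Fin.ofNat 16 (2 * i + 1)) (t (Fin.ofNat 8 i))

theorem partialCombine_eq (b : Pattern) (t : Fin 8 → Bool) {i : ℕ} (hi : i ≤ 8) :
    partialCombine b t i = fun k => if k.val / 2 < i then combine b t k else b k := by
  induction i with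
  | zero => simp [partialCombine]
  | succ i ih =>
    funext k
    rw [partialCombine, ih (by omega)]
    by_cases hk : k = Fin.ofNat 16 (2 * i + 1)
    · subst hk
      have h₁ : (2 * i + 1) % 16 = 2 * i + 1 := by omega
      have h₂ : (2 * i + 1) / 2 = i := by omega
      have h₃ : i % 8 = i := by omega
      simp [combine, Fin.ofNat, h₁, h₂, h₃]
    · rw [Function.update_of_ne hk]
      have : k.val ≠ 2 * i + 1 := fun h => hk (Fin.ext (by simp [Fin.ofNat]; omega))
      by_cases h₁ : k.val / 2 < i
      · simp [h₁, Nat.lt_succ_of_lt h₁]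
      · by_cases h₂ : k.val / 2 < i + 1
        · have : k.val % 2 = 0 := by omega
          simp [h₁, h₂, combine, this]
        · simp [h₁, h₂]

theorem activeFuncs_eq_sum (b : Pattern) :
    activeFuncs b = ∑ i ∈ Finset.range 8, (b (Fin.ofNat 16 (2 * i))).toNat := by
  rw [activeFuncs, Finset.card_filter, Finset.sum_range]
  refine Finset.sum_congr rfl fun i _ => ?_
  have : Fin.ofNat 16 (2 * (i : ℕ)) = ⟨2 * i.val, by omega⟩ :=
    Fin.ext (Nat.mod_eq_of_lt (by omega))
  rw [this, evenBr]
  cases b ⟨2 * i.val, by omega⟩ <;> rfl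

theorem testBit_pairSteps {p : Fin 16 → Fin 16} (hp : p.Injective) {S c : ℕ} {b : Pattern}
    (hS : S.testBit (code p b + 2 ^ 16 * c) = true) {t : Fin 8 → Bool}
    (ht : ∀ i : Fin 8, ((evenBr b i = false ∧ oddBr b i = false) → t i = false) ∧
      (xor (evenBr b i) (oddBr b i) = true → t i = true))
    (hc : c + activeFuncs b < 2 ^ 6) {i : ℕ} (hi : i ≤ 8) :
    (pairSteps p S i).testBit (code p (partialCombine b t i) + 2 ^ 16 *
      (c + ∑ j ∈ Finset.range i, (b (Fin.ofNat 16 (2 * j))).toNat)) = true := by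
  induction i with
  | zero => simpa [pairSteps, partialCombine] using hS
  | succ i ih =>
    have hu : partialCombine b t i (Fin.ofNat 16 (2 * i)) = evenBr b ⟨i, hi⟩ := by
      have h : (2 * i) % 16 = 2 * i := by omega
      rw [partialCombine_eq b t (by omega)]
      simp [evenBr, Fin.ofNat, h]
    have hv : partialCombine b t i (Fin.ofNat 16 (2 * i + 1)) = oddBr b ⟨i, hi⟩ := by
      have h : (2 * i + 1) % 16 = 2 * i + 1 := by omega
      rw [partialCombine_eq b t (by omega)]
      simp [oddBr, Fin.ofNat, h]
      omega
    have hb : b (Fin.ofNat 16 (2 * i)) = evenBr b ⟨i, hi⟩ := by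
      have h : (2 * i) % 16 = 2 * i := by omega
      simp [evenBr, Fin.ofNat, h]
    have hti : t (Fin.ofNat 8 i) = t ⟨i, hi⟩ :=
      congrArg t (Fin.ext (Nat.mod_eq_of_lt hi))
    have hle : ∑ j ∈ Finset.range i, (b (Fin.ofNat 16 (2 * j))).toNat ≤ activeFuncs b := by
      rw [activeFuncs_eq_sum]
      exact Finset.sum_le_sum_of_subset (Finset.range_subset_range.mpr (by omega))
    obtain ⟨h₀, h₁⟩ := ht ⟨i, hi⟩
    have key := testBit_pairStep hp (by omega) (ih (by omega))
      (u := Fin.ofNat 16 (2 * i)) (v := Fin.ofNat 16 (2 * i + 1)) (t := t (Fin.ofNat 8 i))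
      (by
        rw [hu, hv, hti]
        intro h
        cases ho : oddBr b ⟨i, hi⟩
        · exact h₀ ⟨h, ho⟩
        · exact h₁ (by rw [h, ho]; rfl))
      (by
        rw [hu, hv, hti]
        intro h ho
        exact h₁ (by rw [h, ho]; rfl))
    rw [Finset.sum_range_succ, hb, ← hu, ← add_assoc c]
    exact key

theorem shuffle_bijective : shuffle.Bijective := by
  decide

theorem layout_injective (r : ℕ) : (layout r).Injective := by
  induction r with
  | zero => exact Function.injective_id
  | succ r ih => exact ih.comp shuffle_bijective.injective

theorem code_comp_shuffle (p : Fin 16 → Fin 16) (b : Pattern) :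
    code (p ∘ shuffle) (b ∘ shuffle) = code p b :=
  (Equiv.ofBijective shuffle shuffle_bijective).sum_comp fun k => (b k).toNat * 2 ^ (p k : ℕ)

theorem testBit_reachable {b : ℕ → Pattern} (h0 : ∃ k, b 0 k = true) {r : ℕ}
    (hb : ValidTraj r b) (hr : totalActive r b ≤ 38) :
    (reachable r).testBit (code (layout r) (b r) + 2 ^ 16 * totalActive r b) = true := by
  induction r with
  | zero =>
    obtain ⟨k, hk⟩ := h0
    have hlt := code_lt (layout_injective 0) (b 0)
    have hpos : code (layout 0) (b 0) ≠ 0 := by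
      intro h
      have := testBit_code (layout_injective 0) (b 0) k 0
      simp [h, hk] at this
    rw [reachable, Nat.one_shiftLeft, Nat.testBit_two_pow_sub_succ (by norm_num)]
    obtain ⟨m, hm⟩ := Nat.exists_eq_succ_of_ne_zero hpos
    simp [totalActive, hm, Nat.testBit_add_one]
    omega
  | succ r ih =>
    have hsum : totalActive (r + 1) b = totalActive r b + activeFuncs (b r) :=
      Finset.sum_range_succ _ _
    obtain ⟨t, ht, hstep⟩ := hb r (Nat.lt_succ_self r)
    have key := testBit_pairSteps (layout_injective r)
      (ih (fun j hj => hb j (Nat.lt_succ_of_lt hj)) (by omega)) ht (by omega) le_rfl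
    have hcomb : partialCombine (b r) t 8 = combine (b r) t := by
      rw [partialCombine_eq _ _ le_rfl]
      funext k
      exact if_pos (by omega)
    have hcode : code (layout (r + 1)) (b (r + 1)) = code (layout r) (combine (b r) t) := by
      rw [← code_comp_shuffle (layout r), layout]
      exact congrArg _ (funext hstep)
    rw [← activeFuncs_eq_sum, hcomb, ← hcode, ← hsum] at key
    have hlt := code_lt (layout_injective (r + 1)) (b (r + 1))
    rw [reachable, Nat.testBit_and, key, Nat.one_shiftLeft, Nat.testBit_two_pow_sub_one,
      Bool.true_and, decide_eq_true_eq]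
    omega

theorem eighteen_rounds_at_least_39_active :
    ∀ b : ℕ → Pattern, ValidTraj 18 b → (∃ k, b 0 k = true) →
      39 ≤ totalActive 18 b := by
  intro b hb h0
  by_contra! h
  have := testBit_reachable h0 hb (Nat.le_of_lt_succ h)
  rw [reachable_eighteen, Nat.zero_testBit] at this
  exact Bool.false_ne_true this
end
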